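/- For every maximal order O of B_p and every ℤ-basis {v₁, v₂, v₃} of the Gross lattice O^T, the 3×3 Gram matrix with entries ½Tr(v_i·v̄_j) has determinant 4p². -/

import Mathlib

open scoped Quaternion

/-- The rational quaternion algebra with `i² = -p`, `j² = -q`. -/
abbrev Bq (p q : ℕ) := ℍ[ℚ, -(p : ℚ), -(q : ℚ)]

namespace GrossPaper

variable {p q : ℕ}

/-- The (reduced) trace `Tr(x) = x + x̄` of a quaternion, as a rational number. -/
def Trq (x : Bq p q) : ℚ := 2 * x.re

/-- The (reduced) norm `Nr(x) = x·x̄` of a quaternion, as a rational number. -/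
def Nrq (x : Bq p q) : ℚ := (x * star x).re

/-- The inverse of a nonzero quaternion: `c⁻¹ = star c / Nr c`. -/
noncomputable def qinv (c : Bq p q) : Bq p q := (Nrq c)⁻¹ • star c

/-- Conjugation of a set: `c S c⁻¹`. -/
noncomputable def conjSet (c : Bq p q) (S : Set (Bq p q)) : Set (Bq p q) :=
  (fun s => c * s * qinv c) '' S

/-- An order of `B_p`: a subring (hence containing `ℤ`) which is a free `ℤ`-module of
rank 4 spanning `B_p` over `ℚ`. -/
def IsOrder (O : Subring (Bq p q)) : Prop :=
  Nonempty (Module.Basis (Fin 4) ℤ O) ∧ Submodule.span ℚ (O : Set (Bq p q)) = ⊤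

/-- A maximal order: an order not properly contained in any other order. -/
def IsMaximalOrder (O : Subring (Bq p q)) : Prop :=
  IsOrder O ∧ ∀ O' : Subring (Bq p q), IsOrder O' → O ≤ O' → O' = O

/-- Two orders are of the same type if they are conjugate. -/
noncomputable def SameType (O O' : Subring (Bq p q)) : Prop :=
  ∃ c : Bq p q, c ≠ 0 ∧ conjSet c (O : Set (Bq p q)) = (O' : Set (Bq p q))

/-- The Gross lattice `O^T = {2x - Tr(x) : x ∈ O}`. -/
def GrossLat (O : Subring (Bq p q)) : Set (Bq p q) :=
  {t | ∃ x ∈ O, t = 2 * x - algebraMap ℚ (Bq p q) (Trq x)}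

/-- `SuccMin T i D` says `D` is the `i`-th successive minimum of `T`: the least real
number such that `T` contains `i` `ℚ`-linearly independent elements of norm at most `D`. -/
def SuccMin (T : Set (Bq p q)) (i : ℕ) (D : ℝ) : Prop :=
  IsLeast {r : ℝ | ∃ v : Fin i → Bq p q, (∀ n, v n ∈ T) ∧ LinearIndependent ℚ v ∧
    ∀ n, ((Nrq (v n) : ℝ) ≤ r)} D

/-- A primitive element of the Gross lattice. -/
def Primitive (T : Set (Bq p q)) (t : Bq p q) : Prop :=
  t ∈ T ∧ t ≠ 0 ∧ ∀ (a : ℤ) (s : Bq p q), s ∈ T → t = a • s → a = 1 ∨ a = -1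

/-- `k` is represented optimally by `T` : `Nr(t) = k` for some primitive `t ∈ T`. -/
def OptRep (T : Set (Bq p q)) (k : ℝ) : Prop :=
  ∃ t : Bq p q, Primitive T t ∧ (Nrq t : ℝ) = k

/-- The multiplicity `θ_T(k)`: half the number of `t ∈ T` with `Nr t = k`. -/
noncomputable def theta (T : Set (Bq p q)) (k : ℝ) : ℚ :=
  ({t : Bq p q | t ∈ T ∧ (Nrq t : ℝ) = k}.ncard : ℚ) / 2

/-- The optimal multiplicity `θ'_T(k)`: half the number of primitive `t ∈ T` with `Nr t = k`. -/
noncomputable def thetaOpt (T : Set (Bq p q)) (k : ℝ) : ℚ :=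
  ({t : Bq p q | Primitive T t ∧ (Nrq t : ℝ) = k}.ncard : ℚ) / 2

end GrossPaper

open GrossPaper
lemma aux_hensel (l : ℕ) [Fact l.Prime] (c w x : ℤ_[l])
    (h : ‖c * x ^ 2 + w‖ < ‖2 * c * x‖ ^ 2) : ∃ z : ℤ_[l], c * z ^ 2 + w = 0 := by
  have := hensels_lemma (p := l) (F := Polynomial.C c * Polynomial.X ^ 2 + Polynomial.C w) (a := x)
    (by
      simp only [Polynomial.derivative_add, Polynomial.derivative_mul, Polynomial.derivative_C,
        Polynomial.derivative_X_pow, map_add, map_mul, Polynomial.aeval_C, Polynomial.aeval_X, map_pow]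
      simp
      convert h using 2
      simp [mul_assoc, mul_comm, mul_left_comm])
  obtain ⟨z, hz, -⟩ := this
  exact ⟨z, by simpa using hz⟩

/-- solution from integers modulo `l`. -/
lemma aux_lift_odd (l p q : ℕ) [Fact l.Prime] (hl : l ≠ 2)
    (hq : ¬ (l ∣ q)) (a b : ℤ) (hab : (l : ℤ) ∣ a ^ 2 + q * b ^ 2 + p)
    (h : ¬ (l : ℤ) ∣ a ∨ ¬ (l : ℤ) ∣ b) :
    ∃ a b : ℤ_[l], a ^ 2 + q * b ^ 2 + p = 0 := by
  have h2 : ‖(2 : ℤ_[l])‖ = 1 := by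
    have : ‖((2 : ℤ) : ℤ_[l])‖ = 1 := by
      rw [PadicInt.norm_intCast_eq_padic_norm, Padic.norm_intCast_eq_one_iff]
      rw [Int.isCoprime_iff_gcd_eq_one]
      exact_mod_cast ((Nat.coprime_primes Nat.prime_two Fact.out).2 hl.symm)
    simpa using this
  have key : ∀ z : ℤ, ¬ (l : ℤ) ∣ z → ‖(z : ℤ_[l])‖ = 1 := by
    intro z hz
    rw [← PadicInt.norm_int_lt_one_iff_dvd] at hz
    exact le_antisymm (PadicInt.norm_le_one _) (not_lt.1 hz)
  have hs : ‖(a : ℤ_[l]) ^ 2 + q * b ^ 2 + p‖ < 1 := by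
    have := (PadicInt.norm_int_lt_one_iff_dvd (p := l) (a ^ 2 + q * b ^ 2 + p)).2 hab
    simpa using this
  rcases h with h | h
  · obtain ⟨z, hz⟩ := aux_hensel l 1 (q * b ^ 2 + p) a (by
      simp only [norm_mul, h2, key _ h]
      simpa [add_assoc] using hs)
    exact ⟨z, b, by linear_combination hz⟩
  · have hqn : ‖(q : ℤ_[l])‖ = 1 := by
      have := key q (by exact_mod_cast hq)
      simpa using this
    obtain ⟨z, hz⟩ := aux_hensel l q (a ^ 2 + p) b (by
      simp only [norm_mul, h2, key _ h, hqn]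
      have : (q : ℤ_[l]) * b ^ 2 + (a ^ 2 + p) = (a : ℤ_[l]) ^ 2 + q * b ^ 2 + p := by ring
      rw [this]; simpa using hs)
    exact ⟨a, z, by linear_combination hz⟩

lemma aux_lift_two (p q : ℕ) (hp : Odd p) (hq8 : q % 8 = 3) :
    ∃ a b : ℤ_[2], a ^ 2 + q * b ^ 2 + p = 0 := by
  have key : ∀ z : ℤ, ¬ (2 : ℤ) ∣ z → ‖(z : ℤ_[2])‖ = 1 := by
    intro z hz
    have hz' : ¬ ((2 : ℕ) : ℤ) ∣ z := hz
    rw [← PadicInt.norm_int_lt_one_iff_dvd] at hz'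
    exact le_antisymm (PadicInt.norm_le_one _) (not_lt.1 hz')
  have h2 : ‖(2 : ℤ_[2])‖ = 2⁻¹ := by
    simpa using PadicInt.norm_p (p := 2)
  have ex : ∃ a b : ℤ, (8 : ℤ) ∣ a ^ 2 + q * b ^ 2 + p ∧ (¬ (2 : ℤ) ∣ a ∨ ¬ (2 : ℤ) ∣ b) := by
    have : p % 8 = 1 ∨ p % 8 = 3 ∨ p % 8 = 5 ∨ p % 8 = 7 := by
      obtain ⟨k, rfl⟩ := hp; omega
    rcases this with h | h | h | h
    · exact ⟨2, 1, by omega, by omega⟩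
    · exact ⟨1, 2, by omega, by omega⟩
    · exact ⟨0, 1, by omega, by omega⟩
    · exact ⟨1, 0, by omega, by omega⟩
  obtain ⟨a, b, hab, h⟩ := ex
  have hs : ‖(a : ℤ_[2]) ^ 2 + q * b ^ 2 + p‖ < (2⁻¹) ^ 2 := by
    have := (PadicInt.norm_int_le_pow_iff_dvd (p := 2) (k := a ^ 2 + q * b ^ 2 + p) (n := 3)).2
      (by simpa using hab)
    push_cast at this
    refine this.trans_lt ?_
    norm_num [zpow_neg]
  rcases h with h | h
  · obtain ⟨z, hz⟩ := aux_hensel 2 1 (q * b ^ 2 + p) a (by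
      simp only [norm_mul, h2, key _ h]
      simpa [add_assoc] using hs)
    exact ⟨z, b, by linear_combination hz⟩
  · have hqn : ‖(q : ℤ_[2])‖ = 1 := by
      have := key q (by omega)
      simpa using this
    obtain ⟨z, hz⟩ := aux_hensel 2 q (a ^ 2 + p) b (by
      simp only [norm_mul, h2, key _ h, hqn]
      have : (q : ℤ_[2]) * b ^ 2 + (a ^ 2 + p) = (a : ℤ_[2]) ^ 2 + q * b ^ 2 + p := by ring
      rw [this]; simpa using hs)
    exact ⟨a, z, by linear_combination hz⟩

lemma aux_split (l p q : ℕ) [Fact l.Prime] (hp : p.Prime) (hodd : Odd p) (hq : q.Prime)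
    (hq8 : q % 8 = 3) (hqr : ∃ r : ℤ, (q : ℤ) ∣ r ^ 2 + p) (hlp : l ≠ p) :
    ∃ a b : ℤ_[l], a ^ 2 + q * b ^ 2 + p = 0 := by
  have hl : l.Prime := Fact.out
  have hlp' : ¬ (l : ℤ) ∣ p := by
    intro h
    exact hlp ((Nat.prime_dvd_prime_iff_eq hl hp).1 (by exact_mod_cast h))
  by_cases h2 : l = 2
  · subst h2; exact aux_lift_two p q hodd hq8
  by_cases hlq : l = q
  · subst hlq
    obtain ⟨r, hr⟩ := hqr
    have hra : ¬ (l : ℤ) ∣ r := fun h => hlp' (by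
      have : (l : ℤ) ∣ r ^ 2 := dvd_pow h two_ne_zero
      exact (dvd_add_right this).1 hr)
    have key : ∀ z : ℤ, ¬ (l : ℤ) ∣ z → ‖(z : ℤ_[l])‖ = 1 := by
      intro z hz
      rw [← PadicInt.norm_int_lt_one_iff_dvd] at hz
      exact le_antisymm (PadicInt.norm_le_one _) (not_lt.1 hz)
    have h2n : ‖(2 : ℤ_[l])‖ = 1 := by
      have := key 2 (by
        intro h
        exact h2 ((Nat.prime_dvd_prime_iff_eq hl Nat.prime_two).1 (by exact_mod_cast h)))
      simpa using this
    obtain ⟨z, hz⟩ := aux_hensel l 1 p r (by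
      simp only [norm_mul, h2n, key _ hra]
      have := (PadicInt.norm_int_lt_one_iff_dvd (p := l) (r ^ 2 + p)).2 hr
      simpa using this)
    exact ⟨z, 0, by linear_combination hz⟩
  have hlq' : ¬ l ∣ q := fun h => hlq ((Nat.prime_dvd_prime_iff_eq hl hq).1 h)
  have hq0 : (q : ZMod l) ≠ 0 := by rwa [Ne, ZMod.natCast_eq_zero_iff]
  obtain ⟨a, b, hab⟩ := FiniteField.exists_root_sum_quadratic (R := ZMod l)
    (f := Polynomial.X ^ 2 + Polynomial.C (p : ZMod l)) (g := Polynomial.C (q : ZMod l) * Polynomial.X ^ 2)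
    (by compute_degree!) (by compute_degree!) (by
      rw [ZMod.card]; exact (Nat.Prime.eq_two_or_odd hl).resolve_left h2)
  simp only [Polynomial.eval_add, Polynomial.eval_pow, Polynomial.eval_X, Polynomial.eval_C,
    Polynomial.eval_mul] at hab
  obtain ⟨a, rfl⟩ := ZMod.intCast_surjective a
  obtain ⟨b, rfl⟩ := ZMod.intCast_surjective b
  have hd : (l : ℤ) ∣ a ^ 2 + q * b ^ 2 + p := by
    rw [← ZMod.intCast_zmod_eq_zero_iff_dvd]
    push_cast
    linear_combination hab
  refine aux_lift_odd l p q h2 hlq' a b hd ?_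
  by_contra hcon
  push Not at hcon
  apply hlp'
  have h1 : (l : ℤ) ∣ a ^ 2 + q * b ^ 2 :=
    dvd_add (dvd_pow hcon.1 two_ne_zero) (Dvd.dvd.mul_left (dvd_pow hcon.2 two_ne_zero) _)
  exact (dvd_add_right h1).1 hd

lemma aux_nonres (p q : ℕ) [Fact p.Prime] [Fact q.Prime] (hodd : Odd p)
    (hq8 : q % 8 = 3) (hqr : ∃ r : ℤ, (q : ℤ) ∣ r ^ 2 + p) (hpq : p ≠ q) :
    ¬ IsSquare (-(q : ZMod p)) := by
  have hp2 : p ≠ 2 := by rintro rfl; exact absurd hodd (by decide)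
  have hq2 : q ≠ 2 := by omega
  have hsq : IsSquare (-(p : ZMod q)) := by
    obtain ⟨r, hr⟩ := hqr
    rw [← ZMod.intCast_zmod_eq_zero_iff_dvd] at hr
    push_cast at hr
    exact ⟨r, by linear_combination -hr⟩
  have hm1q : ¬ IsSquare (-1 : ZMod q) := by
    rw [ZMod.exists_sq_eq_neg_one_iff]; omega
  have hp0 : (p : ZMod q) ≠ 0 := by
    rw [Ne, ZMod.natCast_eq_zero_iff, Nat.prime_dvd_prime_iff_eq Fact.out Fact.out]
    exact hpq.symm
  have hpns : ¬ IsSquare (p : ZMod q) := by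
    intro h
    apply hm1q
    have := hsq.div h
    rwa [neg_div, div_self hp0] at this
  have hcase : p % 4 = 1 ∨ p % 4 = 3 := by
    obtain ⟨k, rfl⟩ := hodd; omega
  rcases hcase with h | h
  · have h1 : IsSquare (-1 : ZMod p) := by rw [ZMod.exists_sq_eq_neg_one_iff]; omega
    intro hc
    have h2 := h1.mul hc
    rw [neg_mul_neg, one_mul] at h2
    exact hpns ((ZMod.exists_sq_eq_prime_iff_of_mod_four_eq_one h hq2).1 h2)
  · have h1 : ¬ IsSquare (-1 : ZMod p) := by rw [ZMod.exists_sq_eq_neg_one_iff]; omega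
    intro hc
    have h2 : IsSquare (q : ZMod p) :=
      (ZMod.exists_sq_eq_prime_iff_of_mod_four_eq_three h (by omega) hpq).2 hpns
    have hq0 : (q : ZMod p) ≠ 0 := by
      rw [Ne, ZMod.natCast_eq_zero_iff, Nat.prime_dvd_prime_iff_eq Fact.out Fact.out]
      exact hpq
    apply h1
    have := hc.div h2
    rwa [neg_div, div_self hq0] at this

/-- elements `x` with `l^k x ∈ O` for some `k`. -/
def locSubring {p q : ℕ} (O : Subring (Bq p q)) (l : ℕ) : Subring (Bq p q) where
  carrier := {x | ∃ k : ℕ, ((l ^ k : ℕ) : Bq p q) * x ∈ O}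
  mul_mem' := by
    rintro x y ⟨k, hk⟩ ⟨m, hm⟩
    refine ⟨k + m, ?_⟩
    have : ((l ^ (k + m) : ℕ) : Bq p q) * (x * y)
        = (((l ^ k : ℕ) : Bq p q) * x) * (((l ^ m : ℕ) : Bq p q) * y) := by
      rw [pow_add, Nat.cast_mul, mul_assoc, mul_assoc,
        ← mul_assoc x, ← (Nat.cast_commute (l ^ m) x).eq, mul_assoc]
    rw [this]; exact O.mul_mem hk hm
  one_mem' := ⟨0, by simpa using O.one_mem⟩
  add_mem' := by
    rintro x y ⟨k, hk⟩ ⟨m, hm⟩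
    refine ⟨k + m, ?_⟩
    have : ((l ^ (k + m) : ℕ) : Bq p q) * (x + y)
        = ((l ^ m : ℕ) : Bq p q) * (((l ^ k : ℕ) : Bq p q) * x)
          + ((l ^ k : ℕ) : Bq p q) * (((l ^ m : ℕ) : Bq p q) * y) := by
      rw [mul_add, ← mul_assoc, ← mul_assoc, ← Nat.cast_mul, ← Nat.cast_mul, ← pow_add, ← pow_add,
        add_comm m k]
    rw [this]
    exact O.add_mem (O.mul_mem (natCast_mem O _) hk) (O.mul_mem (natCast_mem O _) hm)
  zero_mem' := ⟨0, by simpa using O.zero_mem⟩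
  neg_mem' := by
    rintro x ⟨k, hk⟩
    exact ⟨k, by rw [mul_neg]; exact O.neg_mem hk⟩

lemma isOrder_of_bdd {p q : ℕ} {O X : Subring (Bq p q)} (hO : IsOrder O) (hOX : O ≤ X)
    (m : ℕ) (hm : m ≠ 0) (h : ∀ x ∈ X, (m : Bq p q) * x ∈ O) : IsOrder X := by
  obtain ⟨⟨b⟩, hs⟩ := hO
  refine ⟨?_, ?_⟩
  · have : Module.Finite ℤ O := Module.Finite.of_basis b
    let f : X →ₗ[ℤ] O :=
      { toFun := fun x => ⟨(m : Bq p q) * x.1, h _ x.2⟩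
        map_add' := fun x y => by ext1; simp [mul_add]
        map_smul' := fun c x => by ext1; simp [(Nat.cast_commute m ((c : ℤ) : Bq p q)).left_comm] }
    have hf : Function.Injective f := by
      intro x y hxy
      have h1 : (m : Bq p q) * x.1 = (m : Bq p q) * y.1 := congrArg Subtype.val hxy
      have h2 : (m : ℚ) • x.1 = (m : ℚ) • y.1 := by
        rw [Nat.cast_smul_eq_nsmul, Nat.cast_smul_eq_nsmul, nsmul_eq_mul, nsmul_eq_mul, h1]
      have hm' : (m : ℚ) ≠ 0 := by exact_mod_cast hm
      exact Subtype.ext (smul_right_injective _ hm' h2)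
    let g : O →ₗ[ℤ] X :=
      { toFun := fun x => ⟨x.1, hOX x.2⟩
        map_add' := fun x y => rfl
        map_smul' := fun c x => rfl }
    have hg : Function.Injective g := by
      intro x y hxy
      exact Subtype.ext (congrArg (fun z : X => z.1) hxy)
    have : Module.Finite ℤ X := Module.Finite.of_injective f hf
    have : Module.IsTorsionFree ℤ O := b.isTorsionFree
    have : Module.IsTorsionFree ℤ X := hf.moduleIsTorsionFree f (fun c x => map_smul f c x)
    have : Module.Free ℤ X := inferInstance
    have h4 : Module.finrank ℤ O = 4 := by simp [Module.finrank_eq_card_basis b]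
    have e : Module.finrank ℤ X = 4 :=
      le_antisymm (h4 ▸ LinearMap.finrank_le_finrank_of_injective hf)
        (h4 ▸ LinearMap.finrank_le_finrank_of_injective hg)
    exact ⟨Module.finBasisOfFinrankEq ℤ X e⟩
  · exact top_le_iff.1 (hs ▸ Submodule.span_mono hOX)

/-- Gram matrix of the trace form. -/
def TM {p q : ℕ} (e : Fin 4 → Bq p q) : Matrix (Fin 4) (Fin 4) ℚ :=
  Matrix.of fun i j => Trq (e i * star (e j))

lemma local_det {p q : ℕ} (O : Subring (Bq p q)) (hO : IsMaximalOrder O)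
    (e : Fin 4 → Bq p q) (he : ∀ x, x ∈ O ↔ ∃ c : Fin 4 → ℤ, x = ∑ i, c i • e i)
    (hind : LinearIndependent ℚ e) (hdet : (TM e).det ≠ 0)
    (l : ℕ) [Fact l.Prime] (L : Bq p q →ₗ[ℚ] (Fin 4 → ℚ_[l])) (Ω : Subring (Bq p q))
    (hΩ : ∀ x, x ∈ Ω ↔ ∀ i, ‖L x i‖ ≤ 1) (hOΩ : O ≤ Ω)
    (S : Matrix (Fin 4) (Fin 4) ℚ_[l])
    (hS : ∀ x y, ((Trq (x * star y) : ℚ) : ℚ_[l]) = L x ⬝ᵥ (S.mulVec (L y))) :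
    ‖(((TM e).det : ℚ) : ℚ_[l])‖ = ‖S.det‖ := by
  have hl : l.Prime := Fact.out
  have hl0 : (l : ℚ_[l]) ≠ 0 := by exact_mod_cast hl.ne_zero
  set M : Matrix (Fin 4) (Fin 4) ℚ_[l] := Matrix.of fun i => L (e i) with hM
  have hTM : (TM e).map (Rat.castHom ℚ_[l]) = M * S * M.transpose := by
    ext i j
    simp only [TM, Matrix.map_apply, Matrix.of_apply, Rat.coe_castHom, hS]
    rw [Matrix.mul_assoc, Matrix.mul_apply]
    simp only [dotProduct, Matrix.mulVec, Matrix.mul_apply, Matrix.transpose_apply, hM, Matrix.of_apply]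
  have hTMd : (((TM e).det : ℚ) : ℚ_[l]) = M.det * S.det * M.det := by
    have := congrArg Matrix.det hTM
    rw [Matrix.det_mul, Matrix.det_mul, Matrix.det_transpose] at this
    rw [← this]
    exact (Rat.castHom ℚ_[l]).map_det (TM e)
  have hMdet : M.det ≠ 0 := by
    intro h0
    rw [h0] at hTMd
    simp at hTMd
    exact hdet hTMd
  have hLsum : ∀ c : Fin 4 → ℤ, L (∑ i, c i • e i) = Matrix.vecMul (fun i => (c i : ℚ_[l])) M := by
    intro c
    ext j
    rw [map_sum, Finset.sum_apply]
    refine Finset.sum_congr rfl fun i _ => ?_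
    rw [map_zsmul, Pi.smul_apply, zsmul_eq_mul]
    rfl
  have hLl : ∀ (k : ℕ) (x : Bq p q), L (((l ^ k : ℕ) : Bq p q) * x) = ((l : ℚ_[l]) ^ k) • L x := by
    intro k x
    rw [← nsmul_eq_mul, map_nsmul]
    ext j
    simp
  -- boundedness
  set X := Ω ⊓ locSubring O l with hX
  have hOX : O ≤ X := le_inf hOΩ (fun x hx => ⟨0, by simpa using hx⟩)
  have hl1 : (1 : ℝ) < l := by exact_mod_cast hl.one_lt
  have hbd : ∃ n : ℕ, ∀ i j, ‖M⁻¹ i j‖ ≤ (l : ℝ) ^ n := by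
    obtain ⟨n, hn⟩ := pow_unbounded_of_one_lt (∑ i, ∑ j, ‖M⁻¹ i j‖) hl1
    refine ⟨n, fun i j => le_trans ?_ hn.le⟩
    calc ‖M⁻¹ i j‖ ≤ ∑ j, ‖M⁻¹ i j‖ :=
          Finset.single_le_sum (f := fun j => ‖M⁻¹ i j‖) (fun _ _ => norm_nonneg _) (Finset.mem_univ j)
      _ ≤ _ := Finset.single_le_sum (f := fun i => ∑ j, ‖M⁻¹ i j‖)
          (fun _ _ => Finset.sum_nonneg fun _ _ => norm_nonneg _) (Finset.mem_univ i)
  obtain ⟨n, hn⟩ := hbd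
  have hXO : ∀ x ∈ X, ((l ^ n : ℕ) : Bq p q) * x ∈ O := by
    rintro x ⟨hx1, k, hk⟩
    obtain ⟨c, hc⟩ := (he _).1 hk
    have h1 : ((l : ℚ_[l]) ^ k) • L x = Matrix.vecMul (fun i => (c i : ℚ_[l])) M := by
      rw [← hLl, hc, hLsum]
    have h2 : Matrix.vecMul (((l : ℚ_[l]) ^ k) • L x) M⁻¹ = fun i => (c i : ℚ_[l]) := by
      rw [h1, Matrix.vecMul_vecMul, Matrix.mul_nonsing_inv _ (isUnit_iff_ne_zero.2 hMdet),
        Matrix.vecMul_one]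
    have h3 : ∀ i, (l : ℤ) ^ k ∣ c i * l ^ n := by
      intro i
      have h4 : ((c i * l ^ n : ℤ) : ℚ_[l]) = (l : ℚ_[l]) ^ k * (l ^ n * ∑ j, L x j * M⁻¹ j i) := by
        have := congrFun h2 i
        simp only [Matrix.vecMul, dotProduct, Pi.smul_apply, smul_eq_mul] at this
        push_cast
        rw [← this, Finset.sum_mul, Finset.mul_sum, Finset.mul_sum]
        refine Finset.sum_congr rfl fun j _ => by ring
      have h5 := (Padic.norm_int_le_pow_iff_dvd (p := l) (c i * l ^ n) k).1 (by
        rw [h4, norm_mul, Padic.norm_p_pow]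
        refine mul_le_of_le_one_right (by positivity) ?_
        rw [Finset.mul_sum]
        refine IsUltrametricDist.norm_sum_le_of_forall_le_of_nonneg zero_le_one ?_
        intro j _
        rw [norm_mul, norm_mul, Padic.norm_p_pow, zpow_neg, zpow_natCast]
        have hx := (hΩ x).1 hx1 j
        have hh := hn j i
        have hpos : (0 : ℝ) < (l : ℝ) ^ n := by positivity
        rw [inv_mul_le_iff₀ hpos, mul_one]
        calc _ ≤ 1 * ((l : ℝ) ^ n) := mul_le_mul hx hh (norm_nonneg _) zero_le_one
          _ = _ := one_mul _)
      exact_mod_cast h5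
    choose d hd using h3
    rw [he]
    refine ⟨d, ?_⟩
    have hlk : ((l : ℚ) ^ k) ≠ 0 := pow_ne_zero _ (by exact_mod_cast hl.ne_zero)
    apply smul_right_injective _ hlk
    have e1 : ((l : ℚ) ^ k) • (((l ^ n : ℕ) : Bq p q) * x) = ((l ^ n : ℕ) : Bq p q) * (((l ^ k : ℕ) : Bq p q) * x) := by
      rw [← nsmul_eq_mul (l ^ k) x, ← Nat.cast_smul_eq_nsmul ℚ, mul_smul_comm]; push_cast; rfl
    change ((l : ℚ) ^ k) • (((l ^ n : ℕ) : Bq p q) * x) = ((l : ℚ) ^ k) • (∑ i, d i • e i)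
    rw [e1, hc, Finset.smul_sum, ← nsmul_eq_mul, ← Nat.cast_smul_eq_nsmul ℚ, Finset.smul_sum]
    refine Finset.sum_congr rfl fun i _ => ?_
    rw [← Int.cast_smul_eq_zsmul ℚ, ← Int.cast_smul_eq_zsmul ℚ, smul_smul, smul_smul]
    congr 1
    have := hd i
    push_cast
    have h6 : ((c i * l ^ n : ℤ) : ℚ) = ((l ^ k * d i : ℤ) : ℚ) := by rw [this]
    push_cast at h6
    linarith
  have hXeq : X = O := hO.2 X
    (isOrder_of_bdd hO.1 hOX (l ^ n) (pow_ne_zero _ hl.ne_zero) hXO) hOX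
  -- integrality
  have heO : ∀ i, e i ∈ O := fun i => (he _).2 ⟨Pi.single i 1, by
    rw [Finset.sum_eq_single i] <;> simp +contextual [Pi.single_apply]⟩
  have hMint : ∀ i j, ‖M i j‖ ≤ 1 := fun i j => (hΩ _).1 (hOΩ (heO i)) j
  let M' : Matrix (Fin 4) (Fin 4) ℤ_[l] := Matrix.of fun i j => ⟨M i j, hMint i j⟩
  have hM' : M'.map (PadicInt.Coe.ringHom) = M := by
    ext i j; rfl
  have hM'd : ((M'.det : ℤ_[l]) : ℚ_[l]) = M.det := by
    have : PadicInt.Coe.ringHom M'.det = _ := PadicInt.Coe.ringHom.map_det M'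
    rw [RingHom.mapMatrix_apply, hM'] at this
    exact this
  have hunit : ‖M.det‖ = 1 := by
    rw [← hM'd, PadicInt.padic_norm_e_of_padicInt]
    refine le_antisymm (PadicInt.norm_le_one _) (not_lt.1 fun hlt => ?_)
    have hz : PadicInt.toZMod M'.det = 0 := by
      rw [← RingHom.mem_ker, PadicInt.ker_toZMod, IsLocalRing.mem_maximalIdeal, PadicInt.mem_nonunits]
      exact hlt
    rw [RingHom.map_det] at hz
    obtain ⟨c, hc0, hc⟩ := Matrix.exists_vecMul_eq_zero_iff.2 hz
    choose c' hc' using fun i => ZMod.intCast_surjective (c i)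
    have hdiv : ∀ j, ‖∑ i, (c' i : ℤ_[l]) * M' i j‖ < 1 := by
      intro j
      rw [← PadicInt.mem_nonunits, ← IsLocalRing.mem_maximalIdeal, ← PadicInt.ker_toZMod, RingHom.mem_ker]
      have := congrFun hc j
      simp only [Matrix.vecMul, dotProduct, RingHom.mapMatrix_apply, Matrix.map_apply,
        Pi.zero_apply] at this
      rw [map_sum, ← this]
      refine Finset.sum_congr rfl fun i _ => ?_
      rw [map_mul, map_intCast, hc']
    have hlQ : (l : ℚ) ≠ 0 := by exact_mod_cast hl.ne_zero
    have hxX : ((l : ℚ)⁻¹ • ∑ i, c' i • e i) ∈ X := by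
      refine ⟨(hΩ _).2 fun j => ?_, 1, ?_⟩
      · rw [map_smul, hLsum]
        have h1 : ((l : ℚ)⁻¹ • Matrix.vecMul (fun i => (c' i : ℚ_[l])) M) j
            = (l : ℚ_[l])⁻¹ * ((∑ i, (c' i : ℤ_[l]) * M' i j : ℤ_[l]) : ℚ_[l]) := by
          rw [Pi.smul_apply, Rat.smul_def]
          push_cast
          simp only [Matrix.vecMul, dotProduct]
          congr 1

        rw [h1, norm_mul, norm_inv, Padic.norm_p, inv_inv, PadicInt.padic_norm_e_of_padicInt]
        have h2 := (PadicInt.norm_lt_one_iff_dvd _).1 (hdiv j)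
        obtain ⟨w, hw⟩ := h2
        rw [hw, norm_mul, PadicInt.norm_p, ← mul_assoc, mul_inv_cancel₀ (by positivity), one_mul]
        exact PadicInt.norm_le_one _
      · rw [pow_one, ← nsmul_eq_mul, ← Nat.cast_smul_eq_nsmul ℚ, smul_smul, mul_inv_cancel₀ hlQ, one_smul]
        exact (he _).2 ⟨c', rfl⟩
    rw [hXeq, he] at hxX
    obtain ⟨d, hd⟩ := hxX
    have h7 : ∑ i, ((c' i : ℚ) - l * d i) • e i = 0 := by
      have : ∑ i, c' i • e i = (l : ℚ) • ∑ i, d i • e i := by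
        rw [← hd, smul_smul, mul_inv_cancel₀ hlQ, one_smul]
      simp only [sub_smul, Finset.sum_sub_distrib, mul_smul, ← Finset.smul_sum, Int.cast_smul_eq_zsmul]
      rw [this, sub_self]
    have h8 := Fintype.linearIndependent_iff.1 hind _ h7
    apply hc0
    funext i
    rw [← hc' i]
    have h9 : c' i = l * d i := by
      have := h8 i
      have : (c' i : ℚ) = ((l * d i : ℤ) : ℚ) := by push_cast; linarith
      exact_mod_cast this
    rw [h9]; simp
  rw [hTMd, norm_mul, norm_mul, hunit]; simp

lemma aniso2 (p : ℕ) [Fact p.Prime] (u : ℕ) (hu : ¬ IsSquare (-(u : ZMod p))) (x y : ℚ_[p]) :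
    ‖x ^ 2 + u * y ^ 2‖ = (max ‖x‖ ‖y‖) ^ 2 := by
  have hun : ‖(u : ℚ_[p])‖ = 1 := by
    have h1 : ‖((u : ℤ) : ℚ_[p])‖ ≤ 1 := Padic.norm_int_le_one _
    have h2 : ¬ ‖((u : ℤ) : ℚ_[p])‖ < 1 := by
      rw [Padic.norm_intCast_lt_one_iff]
      intro h
      apply hu
      have : (u : ZMod p) = 0 := by
        rw [ZMod.natCast_eq_zero_iff]; exact_mod_cast h
      rw [this]; simp
    have := le_antisymm h1 (not_lt.1 h2)
    simpa using this
  have hmax : (max ‖x‖ ‖y‖) ^ 2 = max (‖x‖ ^ 2) (‖y‖ ^ 2) := by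
    rcases le_total ‖x‖ ‖y‖ with h | h
    · rw [max_eq_right h, max_eq_right (pow_le_pow_left₀ (norm_nonneg _) h 2)]
    · rw [max_eq_left h, max_eq_left (pow_le_pow_left₀ (norm_nonneg _) h 2)]
  by_cases hxy : ‖x‖ = ‖y‖
  · by_cases hy : y = 0
    · subst hy
      have hx : x = 0 := by simpa using hxy
      simp [hx]
    have hyn : ‖y‖ ≠ 0 := norm_ne_zero_iff.2 hy
    have ht : ‖x / y‖ ≤ 1 := by rw [norm_div, hxy, div_self hyn]
    let t : ℤ_[p] := ⟨x / y, ht⟩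
    have hn : ‖t ^ 2 + u‖ = 1 := by
      refine le_antisymm (PadicInt.norm_le_one _) (not_lt.1 fun hlt => hu ?_)
      rw [← PadicInt.mem_nonunits, ← IsLocalRing.mem_maximalIdeal, ← PadicInt.ker_toZMod,
        RingHom.mem_ker] at hlt
      refine ⟨PadicInt.toZMod t, ?_⟩
      simp only [map_add, map_pow, map_natCast] at hlt
      linear_combination -hlt
    have hn' : ‖(x / y) ^ 2 + (u : ℚ_[p])‖ = 1 := by
      rw [← hn, ← PadicInt.padic_norm_e_of_padicInt]; push_cast; rfl
    have : x ^ 2 + u * y ^ 2 = ((x / y) ^ 2 + (u : ℚ_[p])) * y ^ 2 := by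
      field_simp
    rw [this, norm_mul, hn', hxy, max_self, one_mul, norm_pow]
  · rw [Padic.add_eq_max_of_ne, norm_mul, hun, norm_pow, norm_pow, one_mul, hmax]
    rw [norm_mul, hun, norm_pow, norm_pow, one_mul]
    intro h
    exact hxy ((pow_left_inj₀ (norm_nonneg _) (norm_nonneg _) two_ne_zero).1 h)

lemma norm_cases (p : ℕ) [Fact p.Prime] (x y : ℚ_[p]) :
    max ‖x‖ ‖y‖ = 0 ∨ ∃ n : ℤ, max ‖x‖ ‖y‖ = (p : ℝ) ^ n := by
  have : ∀ z : ℚ_[p], ‖z‖ = 0 ∨ ∃ n : ℤ, ‖z‖ = (p : ℝ) ^ n := by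
    intro z
    by_cases hz : z = 0
    · left; simp [hz]
    · right
      exact ⟨_, Padic.norm_eq_zpow_neg_valuation hz⟩
  rcases max_choice ‖x‖ ‖y‖ with h | h <;> rw [h] <;> apply this

lemma aniso4 (p : ℕ) [Fact p.Prime] (u : ℕ) (hu : ¬ IsSquare (-(u : ZMod p))) (a b c d : ℚ_[p]) :
    ‖(a ^ 2 + u * b ^ 2) + p * (c ^ 2 + u * d ^ 2)‖ ≤ 1 ↔
      (‖a‖ ≤ 1 ∧ ‖b‖ ≤ 1) ∧ (‖c‖ ≤ 1 ∧ ‖d‖ ≤ 1) := by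
  have hp : p.Prime := Fact.out
  have hp1 : (1 : ℝ) < p := by exact_mod_cast hp.one_lt
  have hp0 : (0 : ℝ) < p := by linarith
  have h1 := aniso2 p u hu a b
  have h2 := aniso2 p u hu c d
  rw [← max_le_iff, ← max_le_iff]
  have key : ‖(a ^ 2 + u * b ^ 2) + p * (c ^ 2 + u * d ^ 2)‖
      = max ((max ‖a‖ ‖b‖) ^ 2) ((p : ℝ)⁻¹ * (max ‖c‖ ‖d‖) ^ 2) := by
    by_cases hne : ‖a ^ 2 + u * b ^ 2‖ = ‖(p : ℚ_[p]) * (c ^ 2 + u * d ^ 2)‖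
    · have hne' := hne
      rw [norm_mul, Padic.norm_p, h1, h2] at hne'
      have hz : max ‖a‖ ‖b‖ = 0 := by
        rcases norm_cases p a b with h | ⟨n, hn⟩
        · exact h
        rcases norm_cases p c d with h | ⟨m, hm⟩
        · rw [h] at hne'; simpa using hne'
        exfalso
        rw [hn, hm, ← zpow_natCast, ← zpow_natCast, ← zpow_mul, ← zpow_mul, ← zpow_neg_one,
          ← zpow_add₀ hp0.ne'] at hne'
        have := zpow_right_injective₀ hp0 hp1.ne' hne'
        push_cast at this
        omega
      have hz2 : max ‖c‖ ‖d‖ = 0 := by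
        rw [hz] at hne'
        have : (p : ℝ)⁻¹ ≠ 0 := by positivity
        simpa [this, hp0.ne'] using hne'.symm
      have e1 : a ^ 2 + u * b ^ 2 = 0 := by rw [← norm_eq_zero, h1, hz]; simp
      have e2 : c ^ 2 + u * d ^ 2 = 0 := by rw [← norm_eq_zero, h2, hz2]; simp
      rw [e1, e2, hz, hz2]; simp
    · rw [Padic.add_eq_max_of_ne hne, norm_mul, Padic.norm_p, h1, h2]
  rw [key, max_le_iff]
  have hnn : 0 ≤ max ‖a‖ ‖b‖ := le_max_of_le_left (norm_nonneg _)
  have hnn2 : 0 ≤ max ‖c‖ ‖d‖ := le_max_of_le_left (norm_nonneg _)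
  refine and_congr (sq_le_one_iff₀ hnn) ?_
  rw [inv_mul_le_iff₀ hp0, mul_one]
  rcases norm_cases p c d with h | ⟨m, hm⟩
  · rw [h]; simp [hp0.le]
  · rw [hm, ← zpow_natCast, ← zpow_mul]
    nth_rewrite 2 [← zpow_one (p : ℝ)]
    rw [zpow_le_zpow_iff_right₀ hp1, zpow_le_one_iff_right₀ hp1]
    push_cast
    omega

lemma Nrq_eq {p q : ℕ} (x : Bq p q) :
    Nrq x = x.re ^ 2 + p * x.imI ^ 2 + q * x.imJ ^ 2 + p * q * x.imK ^ 2 := by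
  simp [Nrq]; ring

lemma Trq_eq {p q : ℕ} (x y : Bq p q) :
    Trq (x * star y) = Nrq (x + y) - Nrq x - Nrq y := by
  rw [Nrq_eq, Nrq_eq, Nrq_eq]; simp [Trq]; ring

lemma Nrq_mul {p q : ℕ} (x y : Bq p q) : Nrq (x * y) = Nrq x * Nrq y := by
  rw [Nrq_eq, Nrq_eq, Nrq_eq]; simp; ring

lemma det_at_p {p q : ℕ} (O : Subring (Bq p q)) (hO : IsMaximalOrder O)
    (e : Fin 4 → Bq p q) (he : ∀ x, x ∈ O ↔ ∃ c : Fin 4 → ℤ, x = ∑ i, c i • e i)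
    (hind : LinearIndependent ℚ e) (hdet : (TM e).det ≠ 0)
    [Fact p.Prime] (hp2 : p ≠ 2) (u : ℕ) (hu : ¬ IsSquare (-(u : ZMod p)))
    (L : Bq p q →ₗ[ℚ] (Fin 4 → ℚ_[p]))
    (hL : ∀ x, ((Nrq x : ℚ) : ℚ_[p])
      = (L x 0 ^ 2 + u * L x 1 ^ 2) + p * (L x 2 ^ 2 + u * L x 3 ^ 2)) :
    ‖(((TM e).det : ℚ) : ℚ_[p])‖ = ‖(p : ℚ_[p]) ^ 2‖ := by
  have hp : p.Prime := Fact.out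
  have hint : ∀ x, ‖((Nrq x : ℚ) : ℚ_[p])‖ ≤ 1 ↔ ∀ i, ‖L x i‖ ≤ 1 := by
    intro x
    rw [hL, aniso4 p u hu, Fin.forall_fin_succ, Fin.forall_fin_succ, Fin.forall_fin_succ,
      Fin.forall_fin_succ]
    simp [and_assoc]
  let Ω : Subring (Bq p q) :=
    { carrier := {x | ‖((Nrq x : ℚ) : ℚ_[p])‖ ≤ 1}
      mul_mem' := by
        intro x y hx hy
        simp only [Set.mem_setOf_eq] at *
        rw [Nrq_mul, Rat.cast_mul, norm_mul]
        exact mul_le_one₀ hx (norm_nonneg _) hy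
      one_mem' := by simp [Nrq]
      zero_mem' := by simp [Nrq]
      add_mem' := by
        intro x y hx hy
        simp only [Set.mem_setOf_eq] at *
        rw [hint] at *
        intro i
        rw [map_add, Pi.add_apply]
        exact (Padic.nonarchimedean _ _).trans (max_le (hx i) (hy i))
      neg_mem' := by
        intro x hx
        simp only [Set.mem_setOf_eq] at *
        rw [hint] at *
        intro i
        rw [map_neg, Pi.neg_apply, norm_neg]
        exact hx i }
  have hΩ : ∀ x, x ∈ Ω ↔ ∀ i, ‖L x i‖ ≤ 1 := fun x => hint x
  have hp1 : (1 : ℝ) < p := by exact_mod_cast hp.one_lt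
  have hOΩ : O ≤ Ω := by
    have hbd : ∃ n : ℕ, ∀ i j, ‖L (e i) j‖ ≤ (p : ℝ) ^ n := by
      obtain ⟨n, hn⟩ := pow_unbounded_of_one_lt (∑ i, ∑ j, ‖L (e i) j‖) hp1
      refine ⟨n, fun i j => le_trans ?_ hn.le⟩
      calc ‖L (e i) j‖ ≤ ∑ j, ‖L (e i) j‖ :=
            Finset.single_le_sum (f := fun j => ‖L (e i) j‖) (fun _ _ => norm_nonneg _) (Finset.mem_univ j)
        _ ≤ _ := Finset.single_le_sum (f := fun i => ∑ j, ‖L (e i) j‖)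
            (fun _ _ => Finset.sum_nonneg fun _ _ => norm_nonneg _) (Finset.mem_univ i)
    obtain ⟨n, hn⟩ := hbd
    have hpn : (0 : ℝ) < (p : ℝ) ^ n := by positivity
    have hb : ∀ y ∈ O, ‖((Nrq y : ℚ) : ℚ_[p])‖ ≤ ((p : ℝ) ^ n) ^ 2 := by
      intro y hy
      obtain ⟨c, rfl⟩ := (he y).1 hy
      set y := ∑ i, c i • e i with hy
      have h1 : ‖((Nrq (((p : ℚ) ^ n) • y) : ℚ) : ℚ_[p])‖ ≤ 1 := by
        rw [hint]
        intro j
        rw [map_smul, Pi.smul_apply, Rat.smul_def, norm_mul]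
        push_cast
        rw [Padic.norm_p_pow, zpow_neg, zpow_natCast, inv_mul_le_iff₀ hpn, mul_one, hy, map_sum,
          Finset.sum_apply]
        refine IsUltrametricDist.norm_sum_le_of_forall_le_of_nonneg hpn.le fun i _ => ?_
        rw [map_zsmul, Pi.smul_apply, zsmul_eq_mul, norm_mul]
        calc _ ≤ 1 * ((p : ℝ) ^ n) :=
              mul_le_mul (Padic.norm_int_le_one _) (hn i j) (norm_nonneg _) zero_le_one
          _ = _ := one_mul _
      have h2 : Nrq (((p : ℚ) ^ n) • y) = ((p : ℚ) ^ n) ^ 2 * Nrq y := by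
        rw [Nrq_eq, Nrq_eq]; simp; ring
      rw [h2] at h1
      push_cast at h1
      rw [norm_mul, norm_pow, Padic.norm_p_pow, zpow_neg, zpow_natCast, inv_pow,
        inv_mul_le_iff₀ (by positivity), mul_one] at h1
      exact h1
    intro x hx
    change ‖((Nrq x : ℚ) : ℚ_[p])‖ ≤ 1
    by_contra hcon
    push Not at hcon
    obtain ⟨k, hk⟩ := pow_unbounded_of_one_lt (((p : ℝ) ^ n) ^ 2) hcon
    have hpow : Nrq (x ^ k) = Nrq x ^ k := by
      induction k with
      | zero => simp [Nrq]
      | succ k ih =>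
        clear hk
        have : ∀ k : ℕ, Nrq (x ^ k) = Nrq x ^ k := by
          intro k
          induction k with
          | zero => simp [Nrq]
          | succ k ih => rw [pow_succ, Nrq_mul, ih, pow_succ]
        exact this _
    have := hb (x ^ k) (O.pow_mem hx k)
    rw [hpow, Rat.cast_pow, norm_pow] at this
    linarith
  have := local_det O hO e he hind hdet p L Ω hΩ hOΩ
    (Matrix.diagonal ![2, 2 * (u : ℚ_[p]), 2 * (p : ℚ_[p]), 2 * (p : ℚ_[p]) * u]) (by
      intro x y
      rw [Trq_eq, Rat.cast_sub, Rat.cast_sub, hL, hL, hL, map_add]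
      simp [dotProduct, Matrix.mulVec_diagonal, Fin.sum_univ_four]
      ring)
  rw [this, Matrix.det_diagonal]
  have hun : ‖(u : ℚ_[p])‖ = 1 := by
    have := aniso2 p u hu 0 1
    simpa using this
  have h2n : ‖(2 : ℚ_[p])‖ = 1 := by
    have h1 : ‖((2 : ℤ) : ℚ_[p])‖ ≤ 1 := Padic.norm_int_le_one _
    have h2 : ¬ ‖((2 : ℤ) : ℚ_[p])‖ < 1 := by
      rw [Padic.norm_intCast_lt_one_iff]
      intro h
      exact hp2 ((Nat.prime_dvd_prime_iff_eq hp Nat.prime_two).1 (by exact_mod_cast h))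
    have := le_antisymm h1 (not_lt.1 h2)
    simpa using this
  simp only [Fin.prod_univ_four]
  simp [hun, h2n]
  ring

lemma exists_phi {p q : ℕ} (K : Type*) [Field K] [CharZero K] (a b : K)
    (hab : a ^ 2 + q * b ^ 2 + p = 0) :
    ∃ φ : Bq p q →ₐ[ℚ] Matrix (Fin 2) (Fin 2) K, ∀ x, (φ x).det = (Nrq x : ℚ) := by
  have hab' : a ^ 2 + q * b ^ 2 = -p := by linear_combination hab
  have hq : ∀ r : ℚ, ∀ A : Matrix (Fin 2) (Fin 2) K, r • A = (r : K) • A := by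
    intro r A; ext i j; simp [Rat.smul_def]
  let β : QuaternionAlgebra.Basis (Matrix (Fin 2) (Fin 2) K) (-(p : ℚ)) 0 (-(q : ℚ)) :=
    { i := !![a, q * b; b, -a]
      j := !![0, -(q : K); 1, 0]
      k := !![q * b, -(q * a); -a, -(q * b)]
      i_mul_i := by
        rw [hq, hq]
        ext i j
        fin_cases i <;> fin_cases j <;> simp [Matrix.mul_apply, Fin.sum_univ_two] <;>
          first | ring1 | linear_combination hab
      j_mul_j := by
        rw [hq]
        ext i j
        fin_cases i <;> fin_cases j <;> simp [Matrix.mul_apply, Fin.sum_univ_two]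
      i_mul_j := by
        ext i j
        fin_cases i <;> fin_cases j <;> simp [Matrix.mul_apply, Fin.sum_univ_two] <;> ring
      j_mul_i := by
        rw [hq]
        ext i j
        fin_cases i <;> fin_cases j <;> simp [Matrix.mul_apply, Fin.sum_univ_two] }
  refine ⟨β.liftHom, fun x => ?_⟩
  have : β.liftHom x = β.lift x := rfl
  rw [this, QuaternionAlgebra.Basis.lift, Nrq_eq, Matrix.det_fin_two, hq, hq, hq]
  simp [β, Matrix.algebraMap_matrix_apply]
  linear_combination (-(x.imI : K) ^ 2 - q * (x.imK : K) ^ 2) * hab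

lemma det_at_l {p q : ℕ} (O : Subring (Bq p q)) (hO : IsMaximalOrder O)
    (e : Fin 4 → Bq p q) (he : ∀ x, x ∈ O ↔ ∃ c : Fin 4 → ℤ, x = ∑ i, c i • e i)
    (hind : LinearIndependent ℚ e) (hdet : (TM e).det ≠ 0)
    (l : ℕ) [Fact l.Prime] (a b : ℤ_[l]) (hab : a ^ 2 + q * b ^ 2 + p = 0) :
    ‖(((TM e).det : ℚ) : ℚ_[l])‖ = 1 := by
  obtain ⟨φ, hφ⟩ := exists_phi (p := p) (q := q) ℚ_[l] a b (by exact_mod_cast congrArg (fun z : ℤ_[l] => (z : ℚ_[l])) hab)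
  -- stable lattice
  let V := Fin 2 → ℚ_[l]
  let Λ : Submodule ℤ_[l] V := Submodule.span ℤ_[l]
    (Set.range fun ij : Fin 4 × Fin 2 => (φ (e ij.1)).mulVec (Pi.single ij.2 1))
  have hgen : ∀ x ∈ O, ∀ j, (φ x).mulVec (Pi.single j 1) ∈ Λ := by
    intro x hx j
    obtain ⟨c, rfl⟩ := (he x).1 hx
    rw [map_sum, Matrix.sum_mulVec]
    refine Submodule.sum_mem _ fun i _ => ?_
    rw [map_zsmul, Matrix.smul_mulVec]
    exact Λ.toAddSubgroup.zsmul_mem (Submodule.subset_span (Set.mem_range_self (i, j))) _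
  have hstab : ∀ x ∈ O, ∀ w ∈ Λ, (φ x).mulVec w ∈ Λ := by
    intro x hx w hw
    induction hw using Submodule.span_induction with
    | mem w h =>
      obtain ⟨⟨i, j⟩, rfl⟩ := h
      have heO : e i ∈ O := (he _).2 ⟨Pi.single i 1, by
        rw [Finset.sum_eq_single i] <;> simp +contextual⟩
      simp only [Matrix.mulVec_mulVec, ← map_mul]
      exact hgen _ (O.mul_mem hx heO) j
    | zero => rw [Matrix.mulVec_zero]; exact Λ.zero_mem
    | add u w _ _ hu hw => rw [Matrix.mulVec_add]; exact Λ.add_mem hu hw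
    | smul r w _ hw =>
      have : (φ x).mulVec (r • w) = r • (φ x).mulVec w := by
        rw [Matrix.mulVec_smul]
      rw [this]; exact Λ.smul_mem _ hw
  have hlat : Submodule.IsLattice ℚ_[l] Λ := by
    refine ⟨Submodule.fg_span (Set.finite_range _), ?_⟩
    rw [eq_top_iff]
    rintro w -
    have hw : w = ∑ j, w j • (Pi.single j 1 : V) := by
      ext k; simp [Finset.sum_apply, Pi.single_apply]
    rw [hw]
    refine Submodule.sum_mem _ fun j _ => Submodule.smul_mem _ _ (Submodule.subset_span ?_)
    have := hgen 1 O.one_mem j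
    rw [map_one, Matrix.one_mulVec] at this
    exact this
  have hfr : Module.finrank ℤ_[l] Λ = 2 := by
    rw [Submodule.IsLattice.finrank_of_pi ℚ_[l] Λ]; simp
  let bb : Module.Basis (Fin 2) ℤ_[l] Λ := Module.finBasisOfFinrankEq ℤ_[l] Λ hfr
  let B : Module.Basis (Fin 2) ℚ_[l] V := bb.extendOfIsLattice ℚ_[l]
  have hB : ∀ k, B k = (bb k).1 := fun k => bb.extendOfIsLattice_apply ℚ_[l] k
  have hrep : ∀ w ∈ Λ, ∀ i, ‖B.repr w i‖ ≤ 1 := by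
    intro w hw i
    have h1 : w = ∑ k, ((bb.repr ⟨w, hw⟩ k : ℤ_[l]) : ℚ_[l]) • B k := by
      have h2 := congrArg Subtype.val (bb.sum_repr ⟨w, hw⟩)
      rw [Submodule.coe_sum] at h2
      conv_lhs => rw [← show _ = w from h2]
      refine Finset.sum_congr rfl fun k _ => ?_
      rw [hB]; rfl
    rw [h1, Module.Basis.repr_sum_self]
    exact PadicInt.norm_le_one _
  let ψ : Bq p q → Matrix (Fin 2) (Fin 2) ℚ_[l] := fun x =>
    LinearMap.toMatrixAlgEquiv B (Matrix.toLin' (φ x))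
  have ψ_mul : ∀ x y, ψ (x * y) = ψ x * ψ y := by
    intro x y; simp only [ψ, map_mul, Matrix.toLin'_mul]
    rw [← map_mul]; rfl
  have ψ_add : ∀ x y, ψ (x + y) = ψ x + ψ y := by
    intro x y; simp only [ψ, map_add]
  have ψ_one : ψ 1 = 1 := by
    simp only [ψ, map_one, Matrix.toLin'_one]
    exact map_one (LinearMap.toMatrixAlgEquiv B)
  have ψ_zero : ψ 0 = 0 := by simp only [ψ, map_zero]
  have ψ_neg : ∀ x, ψ (-x) = - ψ x := by intro x; simp only [ψ, map_neg]
  have ψ_smul : ∀ (r : ℚ) x, ψ (r • x) = r • ψ x := by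
    intro r x
    exact (((LinearMap.toMatrixAlgEquiv B).toLinearMap.toAddMonoidHom.comp
      ((Matrix.toLin' : _ ≃ₗ[ℚ_[l]] _).toLinearMap.toAddMonoidHom.comp
        φ.toLinearMap.toAddMonoidHom)).toRatLinearMap).map_smul r x
  have ψ_det : ∀ x, (ψ x).det = (Nrq x : ℚ) := by
    intro x
    rw [← hφ x]
    change (LinearMap.toMatrix B B (Matrix.toLin' (φ x))).det = _
    rw [LinearMap.det_toMatrix, LinearMap.det_toLin']
  have ψ_int : ∀ x ∈ O, ∀ i j, ‖ψ x i j‖ ≤ 1 := by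
    intro x hx i j
    simp only [ψ, LinearMap.toMatrixAlgEquiv_apply]
    apply hrep
    rw [Matrix.toLin'_apply]
    exact hstab x hx _ (by rw [hB]; exact (bb j).2)
  let Ω : Subring (Bq p q) :=
    { carrier := {x | ∀ i j, ‖ψ x i j‖ ≤ 1}
      mul_mem' := by
        intro x y hx hy i j
        rw [ψ_mul, Matrix.mul_apply]
        refine IsUltrametricDist.norm_sum_le_of_forall_le_of_nonneg zero_le_one fun k _ => ?_
        rw [norm_mul]
        exact mul_le_one₀ (hx _ _) (norm_nonneg _) (hy _ _)
      one_mem' := by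
        intro i j
        rw [ψ_one, Matrix.one_apply]; split_ifs <;> simp
      zero_mem' := by
        intro i j
        rw [ψ_zero]; simp
      add_mem' := by
        intro x y hx hy i j
        rw [ψ_add, Matrix.add_apply]
        exact (Padic.nonarchimedean _ _).trans (max_le (hx i j) (hy i j))
      neg_mem' := by
        intro x hx i j
        rw [ψ_neg, Matrix.neg_apply, norm_neg]
        exact hx i j }
  let L : Bq p q →ₗ[ℚ] (Fin 4 → ℚ_[l]) :=
    { toFun := fun x => ![ψ x 0 0, ψ x 0 1, ψ x 1 0, ψ x 1 1]
      map_add' := by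
        intro x y
        ext i; fin_cases i <;> simp [ψ_add]
      map_smul' := by
        intro r x
        ext i; fin_cases i <;> simp [ψ_smul] }
  have hL0 : ∀ x, L x 0 = ψ x 0 0 := fun x => rfl
  have hL1 : ∀ x, L x 1 = ψ x 0 1 := fun x => rfl
  have hL2 : ∀ x, L x 2 = ψ x 1 0 := fun x => rfl
  have hL3 : ∀ x, L x 3 = ψ x 1 1 := fun x => rfl
  have := local_det O hO e he hind hdet l L Ω (by
      intro x
      change (∀ i j, ‖ψ x i j‖ ≤ 1) ↔ _
      simp only [Fin.forall_fin_succ, Fin.forall_fin_two]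
      simp [L, and_assoc]) (fun x hx => ψ_int x hx)
    !![0, 0, 0, 1; 0, 0, -1, 0; 0, -1, 0, 0; 1, 0, 0, 0] (by
      intro x y
      rw [Trq_eq, Rat.cast_sub, Rat.cast_sub, ← ψ_det, ← ψ_det, ← ψ_det, ψ_add]
      simp only [Matrix.det_fin_two, dotProduct, Matrix.mulVec, Fin.sum_univ_four, hL0, hL1, hL2, hL3,
        Matrix.add_apply]
      simp
      ring)
  rw [this]
  simp [Matrix.det_succ_row_zero, Fin.sum_univ_succ, Fin.succAbove]

lemma rat_eq_one (x : ℚ) (hx : 0 < x)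
    (h : ∀ l : ℕ, ∀ _ : Fact l.Prime, ‖(x : ℚ_[l])‖ = 1) : x = 1 := by
  have hn : ∀ l : ℕ, ∀ _ : Fact l.Prime, ‖((x.num : ℤ) : ℚ_[l])‖ = ‖((x.den : ℤ) : ℚ_[l])‖ := by
    intro l hl
    have h1 := h l hl
    have h2 : (x : ℚ_[l]) * ((x.den : ℤ) : ℚ_[l]) = ((x.num : ℤ) : ℚ_[l]) := by
      have := Rat.mul_den_eq_num x
      exact_mod_cast congrArg (fun z : ℚ => (z : ℚ_[l])) this
    rw [← h2, norm_mul, h1, one_mul]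
  have key : ∀ l : ℕ, l.Prime → ((l : ℤ) ∣ x.num ↔ (l : ℤ) ∣ (x.den : ℤ)) := by
    intro l hl
    haveI : Fact l.Prime := ⟨hl⟩
    rw [← Padic.norm_intCast_lt_one_iff, ← Padic.norm_intCast_lt_one_iff, hn l ⟨hl⟩]
  have hcop := x.reduced
  have hno : ∀ l : ℕ, l.Prime → ¬ (l ∣ x.num.natAbs) ∧ ¬ (l ∣ x.den) := by
    intro l hl
    have hk := key l hl
    rw [Int.natCast_dvd, Int.natCast_dvd_natCast] at hk
    constructor
    · intro h1
      exact Nat.not_coprime_of_dvd_of_dvd hl.one_lt h1 (hk.1 h1) hcop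
    · intro h1
      exact Nat.not_coprime_of_dvd_of_dvd hl.one_lt (hk.2 h1) h1 hcop
  have hden : x.den = 1 := Nat.eq_one_iff_not_exists_prime_dvd.2 fun l hl => (hno l hl).2
  have hnum : x.num.natAbs = 1 := Nat.eq_one_iff_not_exists_prime_dvd.2 fun l hl => (hno l hl).1
  have hpos : 0 < x.num := Rat.num_pos.2 hx
  have : x.num = 1 := by omega
  rw [← Rat.num_div_den x, this, hden]; simp

lemma TM_det_pos {p q : ℕ} (hp : 0 < p) (hq : 0 < q) (e : Fin 4 → Bq p q)
    (hind : LinearIndependent ℚ e) : 0 < (TM e).det := by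
  set C : Matrix (Fin 4) (Fin 4) ℚ := Matrix.of fun i => ![(e i).re, (e i).imI, (e i).imJ, (e i).imK] with hC
  have h : TM e = C * Matrix.diagonal ![2, 2 * (p : ℚ), 2 * (q : ℚ), 2 * p * q] * C.transpose := by
    ext i j
    simp [TM, Matrix.mul_apply, Fin.sum_univ_four, hC, Trq, Matrix.diagonal]
    ring
  have hC0 : C.det ≠ 0 := by
    intro h0
    obtain ⟨c, hc0, hc⟩ := Matrix.exists_vecMul_eq_zero_iff.2 h0
    apply hc0
    have h1 : ∑ i, c i • e i = 0 := by
      have h0 := congrFun hc 0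
      have h1 := congrFun hc 1
      have h2 := congrFun hc 2
      have h3 := congrFun hc 3
      simp [Matrix.vecMul, dotProduct, Fin.sum_univ_four, hC] at h0 h1 h2 h3
      ext <;> simp [Fin.sum_univ_four, *]
    funext i
    exact Fintype.linearIndependent_iff.1 hind c h1 i
  rw [h, Matrix.det_mul, Matrix.det_mul, Matrix.det_transpose, Matrix.det_diagonal]
  simp only [Fin.prod_univ_four]
  have : 0 < C.det ^ 2 := by positivity
  have hp' : (0 : ℚ) < p := by exact_mod_cast hp
  have hq' : (0 : ℚ) < q := by exact_mod_cast hq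
  have h3 : (0 : ℚ) < 16 * p ^ 2 * q ^ 2 * C.det ^ 2 := by positivity
  convert h3 using 1
  simp; ring

lemma rat_mem_order {p q : ℕ} (O : Subring (Bq p q)) (hO : IsOrder O) (r : ℚ)
    (hr : algebraMap ℚ (Bq p q) r ∈ O) : ∃ n : ℤ, r = n := by
  obtain ⟨⟨b⟩, -⟩ := hO
  have : Module.Finite ℤ O := Module.Finite.of_basis b
  have h1 : IsIntegral ℤ (⟨_, hr⟩ : O) := IsIntegral.of_finite ℤ _
  have h2 : IsIntegral ℤ (algebraMap ℚ (Bq p q) r) := by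
    obtain ⟨f, hf, hf0⟩ := h1
    refine ⟨f, hf, ?_⟩
    have := congrArg O.subtype hf0
    rw [Polynomial.hom_eval₂, map_zero] at this
    rwa [RingHom.ext_int (algebraMap ℤ (Bq p q)) (O.subtype.comp (algebraMap ℤ ↥O))]
  have hinj : Function.Injective (algebraMap ℚ (Bq p q)) := (algebraMap ℚ (Bq p q)).injective
  have h3 : IsIntegral ℤ r := by
    obtain ⟨f, hf, hf0⟩ := h2
    refine ⟨f, hf, hinj ?_⟩
    rw [Polynomial.hom_eval₂, map_zero]
    rwa [RingHom.ext_int ((algebraMap ℚ (Bq p q)).comp (algebraMap ℤ ℚ)) (algebraMap ℤ (Bq p q))]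
  obtain ⟨n, hn⟩ := IsIntegrallyClosed.isIntegral_iff.1 h3
  exact ⟨n, by simpa using hn.symm⟩

lemma order_det {p q : ℕ} (hp : Nat.Prime p) (hodd : Odd p) (hq : Nat.Prime q)
    (hq8 : q % 8 = 3) (hqr : ∃ r : ℤ, (q : ℤ) ∣ r ^ 2 + p)
    (O : Subring (Bq p q)) (hO : IsMaximalOrder O)
    (e : Fin 4 → Bq p q) (he : ∀ x, x ∈ O ↔ ∃ c : Fin 4 → ℤ, x = ∑ i, c i • e i)
    (hind : LinearIndependent ℚ e) : (TM e).det = (p : ℚ) ^ 2 := by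
  have hpos := TM_det_pos hp.pos hq.pos e hind
  have hp0 : (p : ℚ) ≠ 0 := by exact_mod_cast hp.ne_zero
  have hp' : (0 : ℚ) < p := by exact_mod_cast hp.pos
  suffices (TM e).det / (p : ℚ) ^ 2 = 1 by
    rwa [div_eq_one_iff_eq (pow_ne_zero _ hp0)] at this
  apply rat_eq_one _ (by positivity)
  intro l hl
  rw [Rat.cast_div, Rat.cast_pow, Rat.cast_natCast, norm_div]
  by_cases hlp : l = p
  · subst hlp
    have hp2 : l ≠ 2 := by rintro rfl; exact absurd hodd (by decide)
    have hne : ‖(l : ℚ_[l]) ^ 2‖ ≠ 0 := by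
      rw [norm_ne_zero_iff]; exact pow_ne_zero _ (by exact_mod_cast hp.ne_zero)
    rw [div_eq_one_iff_eq hne]
    by_cases hlq : l = q
    · subst hlq
      refine det_at_p O hO e he hind hpos.ne' hp2 1 ?_
        { toFun := fun x => ![(x.re : ℚ_[l]), l * (x.imK : ℚ_[l]), (x.imI : ℚ_[l]), (x.imJ : ℚ_[l])]
          map_add' := ?_
          map_smul' := ?_ } ?_
      · rw [Nat.cast_one, ZMod.exists_sq_eq_neg_one_iff]; omega
      · intro x y; ext i; fin_cases i <;> simp [mul_add]
      · intro r x; ext i; fin_cases i <;> simp [Rat.smul_def, mul_left_comm]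
      · intro x
        rw [Nrq_eq]; simp; ring
    · haveI : Fact q.Prime := ⟨hq⟩
      refine det_at_p O hO e he hind hpos.ne' hp2 q (aux_nonres l q hodd hq8 hqr hlq)
        { toFun := fun x => ![(x.re : ℚ_[l]), (x.imJ : ℚ_[l]), (x.imI : ℚ_[l]), (x.imK : ℚ_[l])]
          map_add' := ?_
          map_smul' := ?_ } ?_
      · intro x y; ext i; fin_cases i <;> simp
      · intro r x; ext i; fin_cases i <;> simp [Rat.smul_def]
      · intro x
        rw [Nrq_eq]; simp; ring
  · obtain ⟨a, b, hab⟩ := aux_split l p q hp hodd hq hq8 hqr hlp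
    rw [det_at_l O hO e he hind hpos.ne' l a b hab]
    have : ‖((p : ℤ) : ℚ_[l])‖ = 1 := by
      refine le_antisymm (Padic.norm_int_le_one _) (not_lt.1 ?_)
      rw [Padic.norm_intCast_lt_one_iff]
      intro h
      exact hlp ((Nat.prime_dvd_prime_iff_eq Fact.out hp).1 (by exact_mod_cast h))
    rw [Int.cast_natCast] at this
    rw [norm_pow, this]; simp

/-- Lemma determinant: the Gram determinant of the Gross lattice is `4p²`. -/
theorem gross_lattice_det (p q : ℕ) (hp : Nat.Prime p) (hodd : Odd p) (hq : Nat.Prime q)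
    (hq8 : q % 8 = 3) (hqr : ∃ r : ℤ, (q : ℤ) ∣ r ^ 2 + p)
    (O : Subring (Bq p q)) (hO : IsMaximalOrder O)
    (v : Fin 3 → Bq p q) (hindep : LinearIndependent ℚ v)
    (hbasis : ∀ t : Bq p q, t ∈ GrossLat O ↔
      ∃ a b c : ℤ, t = a • v 0 + b • v 1 + c • v 2) :
    (Matrix.of fun i j : Fin 3 => (1 / 2 : ℚ) * Trq (v i * star (v j))).det
      = 4 * (p : ℚ) ^ 2 := by
  have hv : ∀ i, v i ∈ GrossLat O := by
    intro i
    rw [hbasis]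
    fin_cases i
    · exact ⟨1, 0, 0, by simp⟩
    · exact ⟨0, 1, 0, by simp⟩
    · exact ⟨0, 0, 1, by simp⟩
  have al : ∀ r : ℚ, algebraMap ℚ (Bq p q) r = ⟨r, 0, 0, 0⟩ := fun r => rfl
  choose x hxO hx using hv
  have hre : ∀ i, (v i).re = 0 := by
    intro i
    rw [hx i, show (2 : Bq p q) * x i = (2 : ℚ) • x i by rw [two_smul, two_mul], al]
    simp [Trq]
  have hxv : ∀ i, x i = (1 / 2 : ℚ) • v i + algebraMap ℚ (Bq p q) (x i).re := by
    intro i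
    rw [hx i, show (2 : Bq p q) * x i = (2 : ℚ) • x i by rw [two_smul, two_mul], al, al]
    ext <;> simp [Trq]
  set e : Fin 4 → Bq p q := ![1, x 0, x 1, x 2] with he
  have hind : LinearIndependent ℚ e := by
    rw [Fintype.linearIndependent_iff]
    intro g hg
    simp only [Fin.sum_univ_four, he] at hg
    simp at hg
    have hg' : ∑ i : Fin 3, (g i.succ) • v i = 0 := by
      have hr := congrArg QuaternionAlgebra.re hg
      have hi := congrArg QuaternionAlgebra.imI hg
      have hj := congrArg QuaternionAlgebra.imJ hg
      have hk := congrArg QuaternionAlgebra.imK hg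
      rw [hxv 0, hxv 1, hxv 2] at hi hj hk
      simp at hi hj hk
      rw [Fin.sum_univ_three]
      ext
      · simp [hre]
      · simp; linarith
      · simp; linarith
      · simp; linarith
    have h3 := Fintype.linearIndependent_iff.1 hindep (fun i => g i.succ) hg'
    have e1 : g 1 = 0 := h3 0
    have e2 : g 2 = 0 := h3 1
    have e3 : g 3 = 0 := h3 2
    have e0 : g 0 = 0 := by
      rw [e1, e2, e3] at hg
      have hr := congrArg QuaternionAlgebra.re hg
      simpa using hr
    intro i
    fin_cases i <;> assumption
  have hspan : ∀ y, y ∈ O ↔ ∃ c : Fin 4 → ℤ, y = ∑ i, c i • e i := by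
    intro y
    constructor
    · intro hy
      obtain ⟨a, b, c, habc⟩ := (hbasis _).1 ⟨y, hy, rfl⟩
      have hz : y - a • x 0 - b • x 1 - c • x 2 ∈ O :=
        O.sub_mem (O.sub_mem (O.sub_mem hy (O.zsmul_mem (hxO 0) a)) (O.zsmul_mem (hxO 1) b))
          (O.zsmul_mem (hxO 2) c)
      have hz2 : y - a • x 0 - b • x 1 - c • x 2
          = algebraMap ℚ (Bq p q) (y - a • x 0 - b • x 1 - c • x 2).re := by
        rw [show (2 : Bq p q) * y = (2 : ℚ) • y by rw [two_smul, two_mul], al] at habc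
        rw [al]
        simp only [← Int.cast_smul_eq_zsmul ℚ] at habc ⊢
        have hi := congrArg QuaternionAlgebra.imI habc
        have hj := congrArg QuaternionAlgebra.imJ habc
        have hk := congrArg QuaternionAlgebra.imK habc
        simp at hi hj hk
        rw [hxv 0, hxv 1, hxv 2]
        ext
        · simp
        · simp; linarith
        · simp; linarith
        · simp; linarith
      rw [hz2] at hz
      obtain ⟨n, hn⟩ := rat_mem_order O hO.1 _ hz
      refine ⟨![n, a, b, c], ?_⟩
      rw [hn] at hz2
      have h5 : y = algebraMap ℚ (Bq p q) n + a • x 0 + b • x 1 + c • x 2 := by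
        rw [← hz2]; abel
      rw [Fin.sum_univ_four, h5]
      simp [he]
    · rintro ⟨c, rfl⟩
      refine O.sum_mem fun i _ => O.zsmul_mem ?_ _
      fin_cases i
      · exact O.one_mem
      · exact hxO 0
      · exact hxO 1
      · exact hxO 2
  have hmain := order_det hp hodd hq hq8 hqr O hO e hspan hind
  rw [← hmain]
  have hT : TM e = Matrix.of ![![2, 2 * (x 0).re, 2 * (x 1).re, 2 * (x 2).re],
      ![2 * (x 0).re, 2 * (x 0).re * (x 0).re + Trq (v 0 * star (v 0)) / 4,
        2 * (x 0).re * (x 1).re + Trq (v 0 * star (v 1)) / 4,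
        2 * (x 0).re * (x 2).re + Trq (v 0 * star (v 2)) / 4],
      ![2 * (x 1).re, 2 * (x 1).re * (x 0).re + Trq (v 1 * star (v 0)) / 4,
        2 * (x 1).re * (x 1).re + Trq (v 1 * star (v 1)) / 4,
        2 * (x 1).re * (x 2).re + Trq (v 1 * star (v 2)) / 4],
      ![2 * (x 2).re, 2 * (x 2).re * (x 0).re + Trq (v 2 * star (v 0)) / 4,
        2 * (x 2).re * (x 1).re + Trq (v 2 * star (v 1)) / 4,
        2 * (x 2).re * (x 2).re + Trq (v 2 * star (v 2)) / 4]] := by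
    have h1 : Trq ((1 : Bq p q) * star 1) = 2 := by simp [Trq]
    have h2 : ∀ i, Trq (1 * star (x i)) = 2 * (x i).re := by intro i; simp [Trq]
    have h3 : ∀ i, Trq (x i * star 1) = 2 * (x i).re := by intro i; simp [Trq]
    have h4 : ∀ i j, Trq (x i * star (x j)) = 2 * (x i).re * (x j).re + Trq (v i * star (v j)) / 4 := by
      intro i j
      have hi : (x i).imI = (v i).imI / 2 := by
        have := congrArg QuaternionAlgebra.imI (hxv i); simp at this; linarith
      have hj : (x i).imJ = (v i).imJ / 2 := by
        have := congrArg QuaternionAlgebra.imJ (hxv i); simp at this; linarith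
      have hk : (x i).imK = (v i).imK / 2 := by
        have := congrArg QuaternionAlgebra.imK (hxv i); simp at this; linarith
      have hi' : (x j).imI = (v j).imI / 2 := by
        have := congrArg QuaternionAlgebra.imI (hxv j); simp at this; linarith
      have hj' : (x j).imJ = (v j).imJ / 2 := by
        have := congrArg QuaternionAlgebra.imJ (hxv j); simp at this; linarith
      have hk' : (x j).imK = (v j).imK / 2 := by
        have := congrArg QuaternionAlgebra.imK (hxv j); simp at this; linarith
      simp only [Trq, QuaternionAlgebra.re_mul, QuaternionAlgebra.re_star,
        QuaternionAlgebra.imI_star, QuaternionAlgebra.imJ_star, QuaternionAlgebra.imK_star, hi, hj, hk, hi', hj', hk', hre]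
      ring
    ext i j
    fin_cases i <;> fin_cases j
    · exact h1
    · exact h2 0
    · exact h2 1
    · exact h2 2
    · exact h3 0
    · exact h4 0 0
    · exact h4 0 1
    · exact h4 0 2
    · exact h3 1
    · exact h4 1 0
    · exact h4 1 1
    · exact h4 1 2
    · exact h3 2
    · exact h4 2 0
    · exact h4 2 1
    · exact h4 2 2
  rw [hT, Matrix.det_fin_three, Matrix.det_succ_row_zero]
  simp only [Fin.sum_univ_four, Matrix.det_fin_three, Matrix.submatrix_apply, Matrix.of_apply]
  simp [Fin.succAbove]
  ring
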